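/- Let μ₁, μ₂, μ₃ > 0 with μ₃ ≥ μ₁ + μ₂. Then there is no triple (a, b, c) with a, b, c ∈ (0, π), a + b + c = 2π, and sin a / μ₃ = sin b / μ₁ = sin c / μ₂. (If the triangle inequality on the μ_k fails, or holds with equality, there is no relative equilibrium on the Equator.) -/

import Mathlib

/-- If the triangle inequality on the μ_k fails, or holds with equality, there is no
relative equilibrium on the Equator. -/
theorem stmt_7 (μ₁ μ₂ μ₃ : ℝ)
    (hμ₁ : 0 < μ₁) (hμ₂ : 0 < μ₂) (hμ₃ : 0 < μ₃)
    (h : μ₁ + μ₂ ≤ μ₃) :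
    ¬ ∃ a b c : ℝ,
      a ∈ Set.Ioo 0 Real.pi ∧ b ∈ Set.Ioo 0 Real.pi ∧ c ∈ Set.Ioo 0 Real.pi ∧
      a + b + c = 2 * Real.pi ∧
      Real.sin a / μ₃ = Real.sin b / μ₁ ∧
      Real.sin b / μ₁ = Real.sin c / μ₂ := by
  rintro ⟨a, b, c, -, ⟨hb₀, hbπ⟩, ⟨hc₀, hcπ⟩, habc, hab, hbc⟩
  have sin_b_pos : 0 < Real.sin b := Real.sin_pos_of_pos_of_lt_pi hb₀ hbπ
  have sin_c_pos : 0 < Real.sin c := Real.sin_pos_of_pos_of_lt_pi hc₀ hcπ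
  have neg_one_lt_cos {x : ℝ} (h₀ : 0 < x) (hπ : x < Real.pi) : -1 < Real.cos x := by
    simpa using Real.cos_lt_cos_of_nonneg_of_le_pi h₀.le le_rfl hπ
  have cos_b := neg_one_lt_cos hb₀ hbπ
  have cos_c := neg_one_lt_cos hc₀ hcπ
  have sin_a : Real.sin a = -(Real.sin b * Real.cos c + Real.cos b * Real.sin c) := by
    rw [← Real.sin_add, show a = 2 * Real.pi - (b + c) by linarith, Real.sin_two_pi_sub]
  have sin_a_lt : Real.sin a < Real.sin b + Real.sin c := by nlinarith
  obtain ⟨ρ, hρ⟩ : ∃ ρ, ρ = Real.sin b / μ₁ := ⟨_, rfl⟩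
  have ρ_pos : 0 < ρ := hρ ▸ div_pos sin_b_pos hμ₁
  rw [← hρ, div_eq_iff hμ₃.ne'] at hab
  rw [← hρ, eq_div_iff hμ₂.ne'] at hbc
  rw [eq_div_iff hμ₁.ne'] at hρ
  nlinarith [mul_le_mul_of_nonneg_left h ρ_pos.le]
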